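/- arXiv:2406.14945 — 2 statements merged into one kernel-verified Lean document; each statement's English description precedes it below -/
import Mathlib

section
/- Let E = ℝ⁶ with its Euclidean norm ‖·‖ and inner product ⟨·,·⟩. Let V := {(u,v) ∈ E × E : ‖u‖ = ‖v‖ and ⟨u,v⟩ = 1} and T := {(p,t) ∈ E × E : ‖p‖ = 1 and ⟨p,t⟩ = 0}. Then for every (u,v) ∈ V one has u + v ≠ 0, and the map Φ(u,v) = ((u+v)/‖u+v‖, u−v) is a homeomorphism from V onto T. -/
noncomputable section

abbrev E6 := EuclideanSpace ℝ (Fin 6)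

/-- `V = {(u,v) : ‖u‖ = ‖v‖, ⟨u,v⟩ = 1}`. -/
def Vset : Set (E6 × E6) := {p | ‖p.1‖ = ‖p.2‖ ∧ (inner ℝ p.1 p.2 : ℝ) = 1}

/-- `T = {(p,t) : ‖p‖ = 1, ⟨p,t⟩ = 0}`, the tangent bundle of `S⁵`. -/
def Tset : Set (E6 × E6) := {p | ‖p.1‖ = 1 ∧ (inner ℝ p.1 p.2 : ℝ) = 0}

theorem aux_norm (u v : E6) (h : (inner ℝ u v : ℝ) = 1) :
    ‖u + v‖ ^ 2 = ‖u - v‖ ^ 2 + 4 := by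
  rw [norm_add_sq_real, norm_sub_sq_real, h]; ring

theorem aux_norm' (u v : E6) (h : (inner ℝ u v : ℝ) = 1) :
    √(‖u - v‖ ^ 2 + 4) = ‖u + v‖ := by
  rw [← aux_norm u v h, Real.sqrt_sq (norm_nonneg _)]

theorem aux_ne (u v : E6) (h : (inner ℝ u v : ℝ) = 1) : u + v ≠ 0 := by
  intro h0
  have := aux_norm u v h
  rw [h0, norm_zero] at this
  nlinarith [sq_nonneg ‖u - v‖]

theorem aux_fwd (p : E6 × E6) (hp : p ∈ Vset) :
    (‖p.1 + p.2‖⁻¹ • (p.1 + p.2), p.1 - p.2) ∈ Tset := by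
  obtain ⟨h1, h2⟩ := hp
  have h0 := norm_ne_zero_iff.mpr (aux_ne _ _ h2)
  refine ⟨?_, ?_⟩
  · simp only [norm_smul, norm_inv, norm_norm]
    exact inv_mul_cancel₀ h0
  · simp only [real_inner_smul_left]
    rw [(real_inner_add_sub_eq_zero_iff _ _).mpr h1, mul_zero]

theorem aux_bwd (p : E6 × E6) (hp : p ∈ Tset) :
    ((2⁻¹ : ℝ) • (√(‖p.2‖ ^ 2 + 4) • p.1 + p.2),
      (2⁻¹ : ℝ) • (√(‖p.2‖ ^ 2 + 4) • p.1 - p.2)) ∈ Vset := by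
  obtain ⟨h1, h2⟩ := hp
  have hs : √(‖p.2‖ ^ 2 + 4) ^ 2 = ‖p.2‖ ^ 2 + 4 := Real.sq_sqrt (by positivity)
  set s := √(‖p.2‖ ^ 2 + 4)
  have h3 : (inner ℝ (s • p.1) p.2 : ℝ) = 0 := by rw [real_inner_smul_left, h2, mul_zero]
  refine ⟨?_, ?_⟩
  · simp only [norm_smul]
    congr 1
    rw [← sq_eq_sq₀ (norm_nonneg _) (norm_nonneg _), norm_add_sq_real, norm_sub_sq_real, h3]
    ring
  · have h4 : (inner ℝ (s • p.1) (s • p.1) : ℝ) = s ^ 2 := by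
      rw [real_inner_self_eq_norm_sq, norm_smul, h1, mul_one, Real.norm_eq_abs, sq_abs]
    have h5 : (inner ℝ p.2 (s • p.1) : ℝ) = 0 := by rw [real_inner_comm, h3]
    simp only
    rw [real_inner_smul_left, real_inner_smul_right, inner_add_left, inner_sub_right,
      inner_sub_right, h3, h4, h5, real_inner_self_eq_norm_sq p.2]
    rw [hs]; ring

theorem stmt_2 :
    (∀ p ∈ Vset, p.1 + p.2 ≠ 0) ∧
    ∃ φ : Vset ≃ₜ Tset, ∀ p : Vset,
      (φ p : E6 × E6) =
        (‖(p : E6 × E6).1 + (p : E6 × E6).2‖⁻¹ • ((p : E6 × E6).1 + (p : E6 × E6).2),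
         (p : E6 × E6).1 - (p : E6 × E6).2) := by
  refine ⟨fun p hp => aux_ne _ _ hp.2, ?_⟩
  refine ⟨{ toFun := fun p => ⟨_, aux_fwd p.1 p.2⟩
            invFun := fun p => ⟨_, aux_bwd p.1 p.2⟩
            left_inv := ?_
            right_inv := ?_
            continuous_toFun := ?_
            continuous_invFun := ?_ }, fun p => rfl⟩
  · rintro ⟨⟨u, v⟩, h1, h2⟩
    have h0 := norm_ne_zero_iff.mpr (aux_ne u v h2)
    have hn := aux_norm' u v h2
    apply Subtype.ext
    simp only [hn, smul_inv_smul₀ h0]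
    ext1
    · simp only; module
    · simp only; module
  · rintro ⟨⟨q, t⟩, h1, h2⟩
    have hs : 0 < √(‖t‖ ^ 2 + 4) := Real.sqrt_pos.mpr (by positivity)
    have ha : (2⁻¹ : ℝ) • (√(‖t‖ ^ 2 + 4) • q + t) + (2⁻¹ : ℝ) • (√(‖t‖ ^ 2 + 4) • q - t)
        = √(‖t‖ ^ 2 + 4) • q := by module
    have h1' : ‖q‖ = 1 := h1
    apply Subtype.ext
    simp only [ha, norm_smul, h1', mul_one, Real.norm_eq_abs, abs_of_pos hs,
      inv_smul_smul₀ hs.ne']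
    ext1
    · rfl
    · simp only; module
  · refine Continuous.subtype_mk ?_ _
    have hc : Continuous fun p : Vset => ‖p.1.1 + p.1.2‖⁻¹ := by
      refine Continuous.inv₀ (by fun_prop) ?_
      exact fun p => norm_ne_zero_iff.mpr (aux_ne _ _ p.2.2)
    fun_prop
  · refine Continuous.subtype_mk ?_ _
    fun_prop

end
end

section
/- Let U ⊆ ℂ be open and let w : U → ℂ be smooth with |∂̄w(p)| < |∂w(p)| for every p ∈ U. Set J := |∂w|² − |∂̄w|² (so J > 0 on U), define the first-order operator ∂_w acting on smooth functions f : U → ℂ by ∂_w f := ( conj(∂w)·∂f − conj(∂̄w)·∂̄f ) / J, and set ∂_w z := conj(∂w)/J and ∂_{z̄} w̄ := conj(∂w) (both nowhere vanishing). Then for every smooth f : U → ℂ one has, at every point of U: ∂̄(∂_w f) − ∂_w(∂̄ f) = ( ∂̄(∂_w z) / ∂_w z )·∂_w f − ( ∂_w(∂_{z̄} w̄) / ∂_{z̄} w̄ )·∂̄ f. -/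
noncomputable section

/-- The Wirtinger derivative `∂f(p) = ½(Df(p)(1) − i·Df(p)(i))`. -/
def wd (f : ℂ → ℂ) (p : ℂ) : ℂ :=
  (1 / 2) * (fderiv ℝ f p 1 - Complex.I * fderiv ℝ f p Complex.I)

/-- The conjugate Wirtinger derivative `∂̄f(p) = ½(Df(p)(1) + i·Df(p)(i))`. -/
def wdbar (f : ℂ → ℂ) (p : ℂ) : ℂ :=
  (1 / 2) * (fderiv ℝ f p 1 + Complex.I * fderiv ℝ f p Complex.I)

/-- The Jacobian `J = |∂w|² − |∂̄w|²`. -/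
def Jfun (w : ℂ → ℂ) (p : ℂ) : ℝ :=
  ‖wd w p‖ ^ 2 - ‖wdbar w p‖ ^ 2

/-- The coordinate vector field `∂_w f = ( conj(∂w)·∂f − conj(∂̄w)·∂̄f ) / J`. -/
def pw (w : ℂ → ℂ) (f : ℂ → ℂ) (p : ℂ) : ℂ :=
  ((starRingEnd ℂ) (wd w p) * wd f p - (starRingEnd ℂ) (wdbar w p) * wdbar f p) /
    ((Jfun w p : ℝ) : ℂ)

/-- `∂_w z = conj(∂w)/J`. -/
def pwz (w : ℂ → ℂ) (p : ℂ) : ℂ :=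
  (starRingEnd ℂ) (wd w p) / ((Jfun w p : ℝ) : ℂ)

/-- `∂_{z̄} w̄ = conj(∂w)`. -/
def pzbarWbar (w : ℂ → ℂ) (p : ℂ) : ℂ :=
  (starRingEnd ℂ) (wd w p)


theorem aux_wd_diff (f : ℂ → ℂ) (p : ℂ) (hf : ContDiffAt ℝ 2 f p) (v : ℂ) :
    DifferentiableAt ℝ (fun q => fderiv ℝ f q v) p := by
  have h1 : DifferentiableAt ℝ (fderiv ℝ f) p :=
    (hf.fderiv_right (m := 1) (by norm_num)).differentiableAt (by norm_num)
  exact h1.clm_apply (differentiableAt_const v)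

theorem aux_snd (f : ℂ → ℂ) (p : ℂ) (hf : ContDiffAt ℝ 2 f p) (u v : ℂ) :
    fderiv ℝ (fun q => fderiv ℝ f q v) p u = fderiv ℝ (fderiv ℝ f) p u v := by
  have h1 : DifferentiableAt ℝ (fderiv ℝ f) p :=
    (hf.fderiv_right (m := 1) (by norm_num)).differentiableAt (by norm_num)
  have h2 := (h1.hasFDerivAt.clm_apply (hasFDerivAt_const v p)).fderiv
  rw [h2]; simp

theorem aux_dwd (f : ℂ → ℂ) (p : ℂ) (hf : ContDiffAt ℝ 2 f p) :
    DifferentiableAt ℝ (wd f) p := by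
  have h1 := aux_wd_diff f p hf 1
  have h2 := aux_wd_diff f p hf Complex.I
  exact (h1.sub (h2.const_mul Complex.I)).const_mul (1/2)

theorem aux_dwdbar (f : ℂ → ℂ) (p : ℂ) (hf : ContDiffAt ℝ 2 f p) :
    DifferentiableAt ℝ (wdbar f) p := by
  have h1 := aux_wd_diff f p hf 1
  have h2 := aux_wd_diff f p hf Complex.I
  exact (h1.add (h2.const_mul Complex.I)).const_mul (1/2)

theorem aux_fwd_s10 (f : ℂ → ℂ) (p : ℂ) (hf : ContDiffAt ℝ 2 f p) (u : ℂ) :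
    fderiv ℝ (wd f) p u = (1/2) * (fderiv ℝ (fderiv ℝ f) p u 1
      - Complex.I * fderiv ℝ (fderiv ℝ f) p u Complex.I) := by
  have h1 := aux_wd_diff f p hf 1
  have h2 := aux_wd_diff f p hf Complex.I
  have h3 := ((h1.hasFDerivAt.sub (h2.hasFDerivAt.const_mul Complex.I)).const_mul (1/2)).fderiv
  have h4 : fderiv ℝ (wd f) p = _ := h3
  rw [h4]
  simp [aux_snd f p hf]

theorem aux_fwdbar (f : ℂ → ℂ) (p : ℂ) (hf : ContDiffAt ℝ 2 f p) (u : ℂ) :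
    fderiv ℝ (wdbar f) p u = (1/2) * (fderiv ℝ (fderiv ℝ f) p u 1
      + Complex.I * fderiv ℝ (fderiv ℝ f) p u Complex.I) := by
  have h1 := aux_wd_diff f p hf 1
  have h2 := aux_wd_diff f p hf Complex.I
  have h3 := ((h1.hasFDerivAt.add (h2.hasFDerivAt.const_mul Complex.I)).const_mul (1/2)).fderiv
  have h4 : fderiv ℝ (wdbar f) p = _ := h3
  rw [h4]
  simp [aux_snd f p hf]
  ring

theorem aux_comm (f : ℂ → ℂ) (p : ℂ) (hf : ContDiffAt ℝ 2 f p) :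
    wdbar (wd f) p = wd (wdbar f) p := by
  have hs : IsSymmSndFDerivAt ℝ f p := hf.isSymmSndFDerivAt (by simp)
  have := hs.eq 1 Complex.I
  rw [wdbar, wd, aux_fwd_s10 f p hf, aux_fwd_s10 f p hf, aux_fwdbar f p hf, aux_fwdbar f p hf, this]
  ring

theorem aux_mul (f g : ℂ → ℂ) (p : ℂ) (hf : DifferentiableAt ℝ f p)
    (hg : DifferentiableAt ℝ g p) :
    wdbar (fun q => f q * g q) p = wdbar f p * g p + f p * wdbar g p := by
  have h := (hf.hasFDerivAt.mul hg.hasFDerivAt).fderiv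
  have h' : fderiv ℝ (fun q => f q * g q) p = _ := h
  simp only [wdbar, h']
  simp
  ring

theorem aux_sub (f g : ℂ → ℂ) (p : ℂ) (hf : DifferentiableAt ℝ f p)
    (hg : DifferentiableAt ℝ g p) :
    wdbar (fun q => f q - g q) p = wdbar f p - wdbar g p := by
  have h := (hf.hasFDerivAt.sub hg.hasFDerivAt).fderiv
  have h' : fderiv ℝ (fun q => f q - g q) p = _ := h
  simp only [wdbar, h']
  simp
  ring

theorem aux_dconj (g : ℂ → ℂ) (p : ℂ) (hg : DifferentiableAt ℝ g p) :
    DifferentiableAt ℝ (fun q => (starRingEnd ℂ) (g q)) p :=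
  (Complex.conjCLE.toContinuousLinearMap.differentiableAt).comp p hg

theorem aux_fconj (g : ℂ → ℂ) (p : ℂ) (hg : DifferentiableAt ℝ g p) (u : ℂ) :
    fderiv ℝ (fun q => (starRingEnd ℂ) (g q)) p u = (starRingEnd ℂ) (fderiv ℝ g p u) := by
  have h := ((Complex.conjCLE.toContinuousLinearMap.hasFDerivAt).comp p hg.hasFDerivAt).fderiv
  have h' : fderiv ℝ (fun q => (starRingEnd ℂ) (g q)) p = _ := h
  rw [h']; simp

theorem aux_wdbar_conj (g : ℂ → ℂ) (p : ℂ) (hg : DifferentiableAt ℝ g p) :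
    wdbar (fun q => (starRingEnd ℂ) (g q)) p = (starRingEnd ℂ) (wd g p) := by
  simp only [wdbar, wd, aux_fconj g p hg]
  have h2 : (starRingEnd ℂ) 2 = 2 := Complex.conj_ofNat 2
  simp [sub_eq_add_neg, h2]

theorem aux_wd_conj (g : ℂ → ℂ) (p : ℂ) (hg : DifferentiableAt ℝ g p) :
    wd (fun q => (starRingEnd ℂ) (g q)) p = (starRingEnd ℂ) (wdbar g p) := by
  simp only [wdbar, wd, aux_fconj g p hg]
  have h2 : (starRingEnd ℂ) 2 = 2 := Complex.conj_ofNat 2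
  simp [sub_eq_add_neg, h2]

theorem aux_J (w : ℂ → ℂ) (q : ℂ) : ((Jfun w q : ℝ) : ℂ) =
    wd w q * (starRingEnd ℂ) (wd w q) - wdbar w q * (starRingEnd ℂ) (wdbar w q) := by
  rw [Complex.mul_conj, Complex.mul_conj, Complex.normSq_eq_norm_sq, Complex.normSq_eq_norm_sq]
  simp [Jfun]

/-- Commutator formula
`∂̄(∂_w f) − ∂_w(∂̄f) = (∂̄(∂_w z)/∂_w z)·∂_w f − (∂_w(∂_{z̄}w̄)/∂_{z̄}w̄)·∂̄f`. -/
theorem stmt_10 (U : Set ℂ) (hU : IsOpen U) (w : ℂ → ℂ)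
    (hw : ContDiffOn ℝ (⊤ : ℕ∞) w U)
    (hmu : ∀ p ∈ U, ‖wdbar w p‖ < ‖wd w p‖) :
    ∀ f : ℂ → ℂ, ContDiffOn ℝ (⊤ : ℕ∞) f U → ∀ p ∈ U,
      wdbar (pw w f) p - pw w (fun q => wdbar f q) p =
        (wdbar (pwz w) p / pwz w p) * pw w f p -
          (pw w (pzbarWbar w) p / pzbarWbar w p) * wdbar f p := by
  intro f hf p hp
  have hw2 : ContDiffAt ℝ 2 w p := (hw.contDiffAt (hU.mem_nhds hp)).of_le (WithTop.coe_le_coe.2 (le_top : (2 : ℕ∞) ≤ ⊤))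
  have hf2 : ContDiffAt ℝ 2 f p := (hf.contDiffAt (hU.mem_nhds hp)).of_le (WithTop.coe_le_coe.2 (le_top : (2 : ℕ∞) ≤ ⊤))
  have da := aux_dwd w p hw2
  have db := aux_dwdbar w p hw2
  have dA := aux_dconj _ p da
  have dB := aux_dconj _ p db
  have hm := hmu p hp
  have hJ : Jfun w p ≠ 0 := by
    have := norm_nonneg (wdbar w p)
    unfold Jfun
    nlinarith
  have hJc : ((Jfun w p : ℝ) : ℂ) ≠ 0 := by exact_mod_cast hJ
  have hA : (starRingEnd ℂ) (wd w p) ≠ 0 := by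
    have : 0 < ‖wd w p‖ := lt_of_le_of_lt (norm_nonneg _) hm
    simpa using this
  have dJ : DifferentiableAt ℝ (fun q => ((Jfun w q : ℝ) : ℂ)) p := by
    simp only [aux_J]
    exact (da.mul dA).sub (db.mul dB)
  have dP : DifferentiableAt ℝ (pwz w) p := dA.mul (dJ.inv hJc)
  have dQ : DifferentiableAt ℝ
      (fun q => (starRingEnd ℂ) (wdbar w q) / ((Jfun w q : ℝ) : ℂ)) p := dB.mul (dJ.inv hJc)
  have dfz := aux_dwd f p hf2
  have dfb := aux_dwdbar f p hf2
  have e1 : pw w f = fun q => pwz w q * wd f q -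
      ((starRingEnd ℂ) (wdbar w q) / ((Jfun w q : ℝ) : ℂ)) * wdbar f q := by
    funext q; simp only [pw, pwz]; ring
  have e2 := aux_sub _ _ p (dP.mul dfz) (dQ.mul dfb)
  have e2' : wdbar (pw w f) p = _ := (congrArg (fun g => wdbar g p) e1).trans e2
  have m1 := aux_mul _ _ p dP dfz
  have m2 := aux_mul _ _ p dQ dfb
  rw [aux_comm f p hf2] at m1
  replace e2 := e2'.trans (congrArg₂ (fun x y => x - y) m1 m2)
  clear e2' m1 m2
  have e3 : (fun q => ((starRingEnd ℂ) (wdbar w q) / ((Jfun w q : ℝ) : ℂ)) *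
      (starRingEnd ℂ) (wd w q)) = fun q => pwz w q * (starRingEnd ℂ) (wdbar w q) := by
    funext q; simp only [pwz]; ring
  have e4 := congrArg (fun g => wdbar g p) e3
  beta_reduce at e4
  rw [aux_mul _ _ p dQ dA, aux_mul _ _ p dP dB] at e4
  have e5 : wdbar (fun q => (starRingEnd ℂ) (wdbar w q)) p = wd (pzbarWbar w) p := by
    rw [aux_wdbar_conj _ p db, ← aux_comm w p hw2]
    exact (aux_wd_conj _ p da).symm
  have e6 : wdbar (fun q => (starRingEnd ℂ) (wd w q)) p = wdbar (pzbarWbar w) p := rfl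
  rw [e5, e6] at e4
  rw [e2]
  have e9 : pw w (pzbarWbar w) p = (pzbarWbar w p * wd (pzbarWbar w) p - (starRingEnd ℂ) (wdbar w p) * wdbar (pzbarWbar w) p) / ((Jfun w p : ℝ) : ℂ) := rfl
  rw [e9]
  have e7 : (fun q => wdbar f q) = wdbar f := rfl
  rw [e7]
  generalize wdbar (fun q => (starRingEnd ℂ) (wdbar w q) / ((Jfun w q : ℝ) : ℂ)) p = Qb at *
  generalize hPb : wdbar (pwz w) p = Pb at *
  clear hPb e1 e2 e3 e5 e6 e9 dP dQ dJ dA dB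
  generalize wd (pzbarWbar w) p = Az at *
  generalize wdbar (pzbarWbar w) p = Ab at *
  simp only [pw, pwz, pzbarWbar] at *
  generalize (starRingEnd ℂ) (wd w p) = A at *
  generalize (starRingEnd ℂ) (wdbar w p) = B at *
  generalize ((Jfun w p : ℝ) : ℂ) = J at *
  have e8 : Qb = (Pb * B + A / J * Az - B / J * Ab) / A := by
    rw [eq_div_iff hA]; linear_combination e4
  rw [e8]
  field_simp
  ring


end
end
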